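/- Let a ∈ ℝ, T > 0, let α be a positive real number that is not an integer, and let y be ⌈α⌉ times continuously differentiable on [a, a+T]. Then for every fixed t ∈ [a, a+T], the function u ↦ φ̂^D(u, t), where φ̂^D(u, t) = e^u · ( (1/q_D) · φ^D(-u/q_D, t) + (1/(1-q_D)) · φ^D(u/(1-q_D), t) ), is continuous and bounded on [0, ∞). -/

import Mathlib

open Real MeasureTheory Set

/-- The diffusive kernel
`φ^D(w, t) = (-1)^⌊α⌋ · (sin(απ)/π) · e^{w·q_D} · ∫_a^t y^{(⌈α⌉)}(τ) · exp(-(t-τ)·e^w) dτ`,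
with `q_D = α - ⌈α⌉ + 1`. -/
noncomputable def phiD (a T α : ℝ) (y : ℝ → ℝ) (w t : ℝ) : ℝ :=
  (-1 : ℝ) ^ ⌊α⌋ * (Real.sin (α * π) / π) * Real.exp (w * (α - (⌈α⌉ : ℝ) + 1)) *
    ∫ τ in a..t, iteratedDerivWithin ⌈α⌉₊ y (Set.Icc a (a + T)) τ * Real.exp (-(t - τ) * Real.exp w)

/-- The rescaled kernel
`φ̂^D(u, t) = e^u · ((1/q_D)·φ^D(-u/q_D, t) + (1/(1-q_D))·φ^D(u/(1-q_D), t))`. -/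
noncomputable def phiDhat (a T α : ℝ) (y : ℝ → ℝ) (u t : ℝ) : ℝ :=
  Real.exp u *
    ((1 / (α - (⌈α⌉ : ℝ) + 1)) * phiD a T α y (-u / (α - (⌈α⌉ : ℝ) + 1)) t +
     (1 / (1 - (α - (⌈α⌉ : ℝ) + 1))) * phiD a T α y (u / (1 - (α - (⌈α⌉ : ℝ) + 1))) t)

/-- The finite Laplace-type integral `s ↦ ∫_a^t g(τ) e^{-(t-τ)s} dτ` of a function continuous on
`[a, t]` is continuous. -/
lemma continuous_integral_mul_exp {a t : ℝ} (hat : a ≤ t) {g : ℝ → ℝ}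
    (hg : ContinuousOn g (Set.Icc a t)) :
    Continuous fun s : ℝ => ∫ τ in a..t, g τ * Real.exp (-(t - τ) * s) := by
  have hext : Continuous (Set.IccExtend hat ((Set.Icc a t).domRestrict g)) :=
    hg.domRestrict.Icc_extend'
  have heq : (fun s : ℝ => ∫ τ in a..t, g τ * Real.exp (-(t - τ) * s)) = fun s : ℝ =>
      ∫ τ in a..t, Set.IccExtend hat ((Set.Icc a t).domRestrict g) τ * Real.exp (-(t - τ) * s) := by
    funext s
    refine intervalIntegral.integral_congr fun τ hτ => ?_
    rw [Set.uIcc_of_le hat] at hτ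
    simp only [Set.IccExtend_of_mem hat _ hτ, Set.domRestrict_apply]
  rw [heq]
  exact intervalIntegral.continuous_parametric_intervalIntegral_of_continuous' (by fun_prop) a t

lemma abs_integral_mul_exp_le {a t M s : ℝ} (hat : a ≤ t) {g : ℝ → ℝ}
    (hM : ∀ τ ∈ Set.Icc a t, |g τ| ≤ M) (hs : 0 ≤ s) :
    |∫ τ in a..t, g τ * Real.exp (-(t - τ) * s)| ≤ M * (t - a) := by
  rw [← abs_of_nonneg (sub_nonneg.2 hat), ← Real.norm_eq_abs]
  refine intervalIntegral.norm_integral_le_of_norm_le_const fun τ hτ => ?_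
  rw [Set.uIoc_of_le hat] at hτ
  rw [Real.norm_eq_abs, abs_mul, Real.abs_exp]
  have hexp : Real.exp (-(t - τ) * s) ≤ 1 :=
    Real.exp_le_one_iff.2 (mul_nonpos_of_nonpos_of_nonneg (by linarith [hτ.2]) hs)
  exact (mul_le_of_le_one_right (abs_nonneg _) hexp).trans (hM τ (Set.Ioc_subset_Icc_self hτ))

lemma integral_mul_exp_eq (a t s : ℝ) :
    ∫ τ in a..t, s * Real.exp (-(t - τ) * s) = 1 - Real.exp (-(t - a) * s) := by
  have hderiv : ∀ τ ∈ Set.uIcc a t,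
      HasDerivAt (fun τ => Real.exp (-(t - τ) * s)) (s * Real.exp (-(t - τ) * s)) τ := by
    intro τ _
    have h := (((hasDerivAt_id' τ).const_sub t).fun_neg.mul_const s).exp
    rwa [neg_neg, one_mul, mul_comm] at h
  rw [intervalIntegral.integral_eq_sub_of_hasDerivAt hderiv
    (Continuous.intervalIntegrable (by fun_prop) _ _)]
  simp

lemma abs_mul_integral_mul_exp_le {a t M s : ℝ} (hat : a ≤ t) {g : ℝ → ℝ}
    (hM : ∀ τ ∈ Set.Icc a t, |g τ| ≤ M) (hs : 0 ≤ s) :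
    |s * ∫ τ in a..t, g τ * Real.exp (-(t - τ) * s)| ≤ M := by
  have hM0 : 0 ≤ M := (abs_nonneg _).trans (hM a (Set.left_mem_Icc.2 hat))
  rw [← intervalIntegral.integral_const_mul, ← Real.norm_eq_abs]
  calc ‖∫ τ in a..t, s * (g τ * Real.exp (-(t - τ) * s))‖
      ≤ ∫ τ in a..t, M * (s * Real.exp (-(t - τ) * s)) := by
        refine intervalIntegral.norm_integral_le_of_norm_le hat
          (Filter.Eventually.of_forall fun τ hτ => ?_)
          (Continuous.intervalIntegrable (by fun_prop) _ _)
        rw [Real.norm_eq_abs, abs_mul, abs_mul, Real.abs_exp, abs_of_nonneg hs, mul_left_comm]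
        exact mul_le_mul_of_nonneg_right (hM τ (Set.Ioc_subset_Icc_self hτ)) (by positivity)
    _ = M * (1 - Real.exp (-(t - a) * s)) := by
        rw [intervalIntegral.integral_const_mul, integral_mul_exp_eq]
    _ ≤ M := mul_le_of_le_one_right hM0 (by linarith [Real.exp_pos (-(t - a) * s)])

lemma phiDhat_eq {a T α : ℝ} {y : ℝ → ℝ} {t : ℝ} (hq0 : α - (⌈α⌉ : ℝ) + 1 ≠ 0)
    (hq1 : 1 - (α - (⌈α⌉ : ℝ) + 1) ≠ 0) (u : ℝ) :
    phiDhat a T α y u t = (-1 : ℝ) ^ ⌊α⌋ * (Real.sin (α * π) / π) *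
      (1 / (α - (⌈α⌉ : ℝ) + 1) *
        (∫ τ in a..t, iteratedDerivWithin ⌈α⌉₊ y (Set.Icc a (a + T)) τ *
          Real.exp (-(t - τ) * Real.exp (-u / (α - (⌈α⌉ : ℝ) + 1)))) +
       1 / (1 - (α - (⌈α⌉ : ℝ) + 1)) * (Real.exp (u / (1 - (α - (⌈α⌉ : ℝ) + 1))) *
        ∫ τ in a..t, iteratedDerivWithin ⌈α⌉₊ y (Set.Icc a (a + T)) τ *
          Real.exp (-(t - τ) * Real.exp (u / (1 - (α - (⌈α⌉ : ℝ) + 1)))))) := by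
  unfold phiDhat phiD
  generalize α - (⌈α⌉ : ℝ) + 1 = q at *
  have h₁ : Real.exp u * Real.exp (-u / q * q) = 1 := by
    rw [← Real.exp_add, div_mul_cancel₀ _ hq0, add_neg_cancel, Real.exp_zero]
  have h₂ : Real.exp u * Real.exp (u / (1 - q) * q) = Real.exp (u / (1 - q)) := by
    rw [← Real.exp_add]
    congr 1
    field_simp
    ring
  generalize (∫ τ in a..t, iteratedDerivWithin ⌈α⌉₊ y (Set.Icc a (a + T)) τ *
    Real.exp (-(t - τ) * Real.exp (-u / q))) = I
  generalize (∫ τ in a..t, iteratedDerivWithin ⌈α⌉₊ y (Set.Icc a (a + T)) τ *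
    Real.exp (-(t - τ) * Real.exp (u / (1 - q)))) = J
  linear_combination (-1 : ℝ) ^ ⌊α⌋ * (Real.sin (α * π) / π) * (1 / q * I * h₁ +
    1 / (1 - q) * J * h₂)

/-- For every fixed `t ∈ [a, a+T]`, the function `u ↦ φ̂^D(u, t)` is
continuous and bounded on `[0, ∞)`. -/
theorem phiDhat_continuous_bounded (a T α : ℝ) (hT : 0 < T) (hα : 0 < α)
    (hαni : ∀ n : ℤ, α ≠ n)
    (y : ℝ → ℝ) (hy : ContDiffOn ℝ (⌈α⌉₊ : ℕ∞) y (Set.Icc a (a + T)))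
    (t : ℝ) (ht : t ∈ Set.Icc a (a + T)) :
    ContinuousOn (fun u => phiDhat a T α y u t) (Set.Ici 0) ∧
    ∃ M : ℝ, ∀ u ∈ Set.Ici (0 : ℝ), |phiDhat a T α y u t| ≤ M := by
  have hlt : α < ⌈α⌉ := lt_of_le_of_ne (Int.le_ceil α) (hαni _)
  have hq0 : 0 < α - (⌈α⌉ : ℝ) + 1 := by linarith [Int.ceil_lt_add_one α]
  have hq1 : 0 < 1 - (α - (⌈α⌉ : ℝ) + 1) := by linarith
  have hg : ContinuousOn (iteratedDerivWithin ⌈α⌉₊ y (Set.Icc a (a + T))) (Set.Icc a t) :=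
    (hy.continuousOn_iteratedDerivWithin le_rfl (uniqueDiffOn_Icc (by linarith))).mono
      (Set.Icc_subset_Icc_right ht.2)
  obtain ⟨M, hM⟩ := isCompact_Icc.exists_bound_of_continuousOn hg
  simp only [Real.norm_eq_abs] at hM
  have hcont := continuous_integral_mul_exp ht.1 hg
  simp only [phiDhat_eq hq0.ne' hq1.ne']
  generalize α - (⌈α⌉ : ℝ) + 1 = q at *
  constructor
  · have h₁ := hcont.comp (show Continuous fun u : ℝ => Real.exp (-u / q) by fun_prop)
    have h₂ := hcont.comp (show Continuous fun u : ℝ => Real.exp (u / (1 - q)) by fun_prop)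
    exact (continuous_const.mul ((continuous_const.mul h₁).add (continuous_const.mul
      ((show Continuous fun u : ℝ => Real.exp (u / (1 - q)) by fun_prop).mul h₂)))).continuousOn
  · refine ⟨|(-1 : ℝ) ^ ⌊α⌋ * (Real.sin (α * π) / π)| *
      (1 / q * (M * (t - a)) + 1 / (1 - q) * M), fun u _ => ?_⟩
    rw [abs_mul]
    refine mul_le_mul_of_nonneg_left ((abs_add_le _ _).trans (add_le_add ?_ ?_)) (abs_nonneg _)
    · rw [abs_mul, abs_of_pos (one_div_pos.2 hq0)]
      exact mul_le_mul_of_nonneg_left (abs_integral_mul_exp_le ht.1 hM (Real.exp_pos _).le)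
        (one_div_pos.2 hq0).le
    · rw [abs_mul, abs_of_pos (one_div_pos.2 hq1)]
      exact mul_le_mul_of_nonneg_left (abs_mul_integral_mul_exp_le ht.1 hM (Real.exp_pos _).le)
        (one_div_pos.2 hq1).le
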